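/- There is no 3-γ_t-critical graph G of order Δ(G) + 3 with Δ(G) = 7; that is, no 3-γ_t-critical graph on 10 vertices has maximum degree 7. -/

import Mathlib

open SimpleGraph

/-- `S` is a total dominating set of `G`: every vertex of `G` has a neighbor in `S`. -/
def IsTDS {V : Type*} (G : SimpleGraph V) (S : Set V) : Prop :=
  ∀ v : V, ∃ u ∈ S, G.Adj v u

/-- The total domination number `γₜ(G)`: the minimum cardinality of a total dominating set. -/
noncomputable def gammaT {V : Type*} (G : SimpleGraph V) : ℕ :=
  sInf {n : ℕ | ∃ S : Set V, IsTDS G S ∧ S.ncard = n}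

/-- The degree of a vertex. -/
noncomputable def deg {V : Type*} (G : SimpleGraph V) (v : V) : ℕ :=
  (G.neighborSet v).ncard

/-- The maximum degree `Δ(G)`. -/
noncomputable def maxDeg {V : Type*} [Fintype V] (G : SimpleGraph V) : ℕ :=
  Finset.univ.sup fun v => deg G v

/-- The vertex-deleted graph `G − v`. -/
def delVert {V : Type*} (G : SimpleGraph V) (v : V) : SimpleGraph {u : V // u ≠ v} :=
  G.induce {u : V | u ≠ v}

/-- `G` is 3-γₜ-critical: `γₜ(G) = 3` and for every vertex `v` that is not adjacent to a
vertex of degree one, `γₜ(G − v) = 2`. -/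
def IsThreeGammaTCritical {V : Type*} (G : SimpleGraph V) : Prop :=
  gammaT G = 3 ∧
    ∀ v : V, (¬ ∃ u : V, G.Adj v u ∧ deg G u = 1) → gammaT (delVert G v) = 2


inductive Fm where
  | tt | ff
  | lit (v : Nat) (b : Bool)
  | and (x y : Fm)
  | or (x y : Fm)

namespace Fm

def eval (g : Nat → Bool) : Fm → Bool
  | tt => true
  | ff => false
  | lit v b => g v == b
  | and x y => eval g x && eval g y
  | or x y => eval g x || eval g y

def sub (v : Nat) (b : Bool) : Fm → Fm
  | tt => tt
  | ff => ff
  | lit w c => bif Nat.beq v w then (bif b then (bif c then tt else ff) else (bif c then ff else tt)) else lit w c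
  | and x y =>
    match sub v b x with
    | ff => ff
    | tt => sub v b y
    | lit w c => match sub v b y with
      | ff => ff
      | tt => lit w c
      | y' => and (lit w c) y'
    | and p q => match sub v b y with
      | ff => ff
      | tt => and p q
      | y' => and (and p q) y'
    | or p q => match sub v b y with
      | ff => ff
      | tt => or p q
      | y' => and (or p q) y'
  | or x y =>
    match sub v b x with
    | tt => tt
    | ff => sub v b y
    | lit w c => match sub v b y with
      | tt => tt
      | ff => lit w c
      | y' => or (lit w c) y'
    | and p q => match sub v b y with
      | tt => tt
      | ff => and p q
      | y' => or (and p q) y'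
    | or p q => match sub v b y with
      | tt => tt
      | ff => or p q
      | y' => or (or p q) y'

def refute : List Nat → Fm → Bool
  | _, ff => true
  | [], _ => false
  | v :: l, x => refute l (sub v true x) && refute l (sub v false x)

/-- big conjunction -/
def all : List Nat → (Nat → Fm) → Fm
  | [], _ => tt
  | a :: l, f => and (f a) (all l f)

def any : List Nat → (Nat → Fm) → Fm
  | [], _ => ff
  | a :: l, f => or (f a) (any l f)

def ed (i j : Nat) (b : Bool) : Fm := lit (bif Nat.ble i j then 7 * i + j else 7 * j + i) b

def ne (l : List Nat) (a : Nat) : List Nat := l.filter (fun x => x != a)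

/-- conditions for the side X -/
def nonfull (X Y : List Nat) : Fm := all X fun a => any Y fun b => ed a b false

def crit (X Y : List Nat) : Fm :=
  all X fun a => or
    (any Y fun c => and (ed a c false) (all (ne X a) fun a' => ed a' c true))
    (any (ne X a) fun c => any Y fun d => and (ed c d true) (and (ed a c false) (and (ed a d false)
      (all (ne (ne (ne (X ++ Y) a) c) d) fun u => or (ed u c true) (ed u d true)))))

def nodom (X Y : List Nat) : Fm :=
  all X fun c => all Y fun d => or (ed c d false)
    (any (ne (ne (X ++ Y) c) d) fun u => and (ed c u false) (ed d u false))

def total (X Y : List Nat) : Fm :=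
  and (nonfull X Y) (and (nonfull Y X) (and (crit X Y) (and (crit Y X) (nodom X Y))))

/-- neighbourhoods of the second side are sorted -/
def lexs (Z : List Nat) : Fm :=
  all Z fun b => and (or (ed 0 b false) (ed 0 (b + 1) true))
    (or (and (ed 0 b false) (ed 0 (b + 1) true)) (or (ed 1 b false) (ed 1 (b + 1) true)))

theorem refute1 : refute [1,2,3,4,5,6] (total [0] [1,2,3,4,5,6]) = true := by decide +kernel

theorem refute2 : refute [2,3,4,5,6,9,10,11,12,13,1,17,18,19,20,25,26,27,33,34,41]
    (and (lexs [2,3,4,5]) (total [0,1] [2,3,4,5,6])) = true := by decide +kernel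

theorem refute3 : refute [3,4,5,6,10,11,12,13,17,18,19,20,1,2,9,25,26,27,33,34,41]
    (and (lexs [3,4,5]) (total [0,1,2] [3,4,5,6])) = true := by decide +kernel

theorem eval_sub (g : Nat → Bool) (v : Nat) (F : Fm) : eval g (sub v (g v) F) = eval g F := by
  induction F with
  | tt => rfl
  | ff => rfl
  | lit w c =>
    simp only [sub]
    cases h : Nat.beq v w
    · rfl
    · have := Nat.eq_of_beq_eq_true h
      subst this
      cases hg : g v <;> cases c <;> simp [eval, hg]
  | and x y hx hy =>
    simp only [sub, eval, ← hx, ← hy]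
    cases sub v (g v) x <;> cases sub v (g v) y <;> simp [eval]
  | or x y hx hy =>
    simp only [sub, eval, ← hx, ← hy]
    cases sub v (g v) x <;> cases sub v (g v) y <;> simp [eval]

theorem refute_sound (g : Nat → Bool) (l : List Nat) (F : Fm) (h : refute l F = true) :
    eval g F = false := by
  induction l generalizing F with
  | nil => cases F <;> simp_all [refute, eval]
  | cons v l ih =>
    have key : refute l (sub v true F) = true ∧ refute l (sub v false F) = true →
        eval g F = false := by
      rintro ⟨h1, h2⟩
      rw [← eval_sub g v F]
      cases g v
      · exact ih _ h2
      · exact ih _ h1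
    cases F <;> first | rfl | (apply key; simpa [refute] using h)

theorem eval_and (g : Nat → Bool) (x y : Fm) :
    eval g (and x y) = true ↔ eval g x = true ∧ eval g y = true := by simp [eval]

theorem eval_or (g : Nat → Bool) (x y : Fm) :
    eval g (or x y) = true ↔ eval g x = true ∨ eval g y = true := by simp [eval]

theorem eval_all (g : Nat → Bool) (l : List Nat) (f : Nat → Fm) :
    eval g (all l f) = true ↔ ∀ i ∈ l, eval g (f i) = true := by
  induction l with
  | nil => simp [all, eval]
  | cons a l ih => simp [all, eval, ← ih]

theorem eval_any (g : Nat → Bool) (l : List Nat) (f : Nat → Fm) :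
    eval g (any l f) = true ↔ ∃ i ∈ l, eval g (f i) = true := by
  induction l with
  | nil => simp [any, eval]
  | cons a l ih => simp [any, eval, ← ih]

theorem mem_ne (l : List Nat) (a i : Nat) : i ∈ ne l a ↔ i ∈ l ∧ i ≠ a := by
  simp [ne]

section graph
variable {V : Type*} (G : SimpleGraph V) (f : Nat → V)

open Classical in
/-- the assignment coming from a labelled graph -/
noncomputable def asg (n : Nat) : Bool := decide (G.Adj (f (n / 7)) (f (n % 7)))

theorem eval_ed_true (i j : Nat) (hi : i < 7) (hj : j < 7) :
    eval (asg G f) (ed i j true) = true ↔ G.Adj (f i) (f j) := by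
  unfold ed
  cases h : Nat.ble i j
  · have h1 : (7 * j + i) / 7 = j := by omega
    have h2 : (7 * j + i) % 7 = i := by omega
    simp [eval, asg, h1, h2, G.adj_comm]
  · have h1 : (7 * i + j) / 7 = i := by omega
    have h2 : (7 * i + j) % 7 = j := by omega
    simp [eval, asg, h1, h2]

theorem eval_ed_false (i j : Nat) (hi : i < 7) (hj : j < 7) :
    eval (asg G f) (ed i j false) = true ↔ ¬ G.Adj (f i) (f j) := by
  rw [← eval_ed_true G f i j hi hj]
  simp [ed, eval]

/-- `X` enumerates `P` through the labelling `f`. -/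
def Enum (f : Nat → V) (X : List Nat) (P : Set V) : Prop :=
  (∀ i ∈ X, i < 7 ∧ f i ∈ P) ∧ ∀ w ∈ P, ∃ i ∈ X, f i = w

variable {G f}
variable {X Y : List Nat} {P Q : Set V}

theorem eval_nonfull (hX : Enum f X P) (hY : Enum f Y Q)
    (h : ∀ a ∈ P, ∃ b ∈ Q, ¬ G.Adj a b) : eval (asg G f) (nonfull X Y) = true := by
  unfold nonfull
  rw [eval_all]
  intro i hi
  rw [eval_any]
  obtain ⟨b, hb, hab⟩ := h _ (hX.1 i hi).2
  obtain ⟨j, hj, rfl⟩ := hY.2 b hb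
  exact ⟨j, hj, (eval_ed_false G f i j (hX.1 i hi).1 (hY.1 j hj).1).2 hab⟩

theorem eval_nodom (hX : Enum f X P) (hY : Enum f Y Q)
    (h : ∀ c ∈ P, ∀ d ∈ Q, ∃ u, (u ∈ P ∨ u ∈ Q) ∧ ¬ G.Adj c u ∧ ¬ G.Adj d u) :
    eval (asg G f) (nodom X Y) = true := by
  unfold nodom
  rw [eval_all]
  intro i hi
  rw [eval_all]
  intro j hj
  have hi7 := (hX.1 i hi).1
  have hj7 := (hY.1 j hj).1
  rw [eval_or, eval_ed_false G f i j hi7 hj7]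
  by_cases hadj : G.Adj (f i) (f j)
  · right
    rw [eval_any]
    obtain ⟨u, hu, hiu, hju⟩ := h _ (hX.1 i hi).2 _ (hY.1 j hj).2
    have : ∃ k ∈ X ++ Y, f k = u ∧ k < 7 := by
      rcases hu with hu | hu
      · obtain ⟨k, hk, hk'⟩ := hX.2 u hu
        exact ⟨k, by simp [hk], hk', (hX.1 k hk).1⟩
      · obtain ⟨k, hk, hk'⟩ := hY.2 u hu
        exact ⟨k, by simp [hk], hk', (hY.1 k hk).1⟩
    obtain ⟨k, hk, rfl, hk7⟩ := this
    refine ⟨k, ?_, ?_⟩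
    · rw [mem_ne, mem_ne]
      refine ⟨⟨hk, ?_⟩, ?_⟩
      · rintro rfl
        exact hju hadj.symm
      · rintro rfl
        exact hiu hadj
    · rw [eval_and, eval_ed_false G f i k hi7 hk7, eval_ed_false G f j k hj7 hk7]
      exact ⟨hiu, hju⟩
  · exact Or.inl hadj

/-- the criticality condition for the vertices of `P` -/
def CritSide (G : SimpleGraph V) (P Q : Set V) : Prop :=
  ∀ a ∈ P, (∃ c ∈ Q, ¬ G.Adj a c ∧ ∀ a' ∈ P, a' ≠ a → G.Adj a' c) ∨
    ∃ c ∈ P, ∃ d ∈ Q, G.Adj c d ∧ ¬ G.Adj a c ∧ ¬ G.Adj a d ∧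
      ∀ u, (u ∈ P ∨ u ∈ Q) → u ≠ a → G.Adj u c ∨ G.Adj u d

theorem eval_crit (hX : Enum f X P) (hY : Enum f Y Q)
    (hinj : ∀ i ∈ X ++ Y, ∀ j ∈ X ++ Y, f i = f j → i = j)
    (h : CritSide G P Q) : eval (asg G f) (crit X Y) = true := by
  unfold crit
  rw [eval_all]
  intro i hi
  have hi7 := (hX.1 i hi).1
  rw [eval_or]
  rcases h _ (hX.1 i hi).2 with ⟨c, hc, hac, hall⟩ | ⟨c, hc, d, hd, hcd, hac, had, hall⟩
  · left
    obtain ⟨k, hk, rfl⟩ := hY.2 c hc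
    have hk7 := (hY.1 k hk).1
    rw [eval_any]
    refine ⟨k, hk, ?_⟩
    rw [eval_and, eval_ed_false G f i k hi7 hk7, eval_all]
    refine ⟨hac, ?_⟩
    intro j hj
    rw [mem_ne] at hj
    rw [eval_ed_true G f j k (hX.1 j hj.1).1 hk7]
    refine hall _ (hX.1 j hj.1).2 ?_
    intro he
    exact hj.2 (hinj j (by simp [hj.1]) i (by simp [hi]) he)
  · right
    obtain ⟨k, hk, rfl⟩ := hX.2 c hc
    obtain ⟨l, hl, rfl⟩ := hY.2 d hd
    have hk7 := (hX.1 k hk).1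
    have hl7 := (hY.1 l hl).1
    rw [eval_any]
    refine ⟨k, ?_, ?_⟩
    · rw [mem_ne]
      refine ⟨hk, ?_⟩
      rintro rfl
      exact had hcd
    rw [eval_any]
    refine ⟨l, hl, ?_⟩
    rw [eval_and, eval_and, eval_and, eval_ed_true G f k l hk7 hl7,
      eval_ed_false G f i k hi7 hk7, eval_ed_false G f i l hi7 hl7, eval_all]
    refine ⟨hcd, hac, had, ?_⟩
    intro u hu
    rw [mem_ne, mem_ne, mem_ne] at hu
    obtain ⟨⟨⟨hu, hui⟩, -⟩, -⟩ := hu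
    have hu' : u < 7 ∧ (f u ∈ P ∨ f u ∈ Q) := by
      rcases List.mem_append.1 hu with hu | hu
      · exact ⟨(hX.1 u hu).1, Or.inl (hX.1 u hu).2⟩
      · exact ⟨(hY.1 u hu).1, Or.inr (hY.1 u hu).2⟩
    rw [eval_or, eval_ed_true G f u k hu'.1 hk7, eval_ed_true G f u l hu'.1 hl7]
    refine hall _ hu'.2 ?_
    intro he
    exact hui (hinj u hu i (by simp [hi]) he)

/-- The combinatorial conditions on the bipartition `P`, `Q` of the neighbourhood. -/
structure Cfg (G : SimpleGraph V) (P Q : Set V) : Prop where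
  disj : ∀ w, w ∈ P → w ∈ Q → False
  nfP : ∀ a ∈ P, ∃ b ∈ Q, ¬ G.Adj a b
  nfQ : ∀ a ∈ Q, ∃ b ∈ P, ¬ G.Adj a b
  nd : ∀ c ∈ P, ∀ d ∈ Q, ∃ u, (u ∈ P ∨ u ∈ Q) ∧ ¬ G.Adj c u ∧ ¬ G.Adj d u
  crP : CritSide G P Q
  crQ : CritSide G Q P

theorem eval_total (H : Cfg G P Q) (hX : Enum f X P) (hY : Enum f Y Q)
    (hinj : ∀ i ∈ X ++ Y, ∀ j ∈ X ++ Y, f i = f j → i = j) :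
    eval (asg G f) (total X Y) = true := by
  unfold total
  rw [eval_and, eval_and, eval_and, eval_and]
  refine ⟨eval_nonfull hX hY H.nfP, eval_nonfull hY hX H.nfQ, eval_crit hX hY hinj H.crP,
    eval_crit hY hX ?_ H.crQ, eval_nodom hX hY H.nd⟩
  intro i hi j hj
  apply hinj
  · simp only [List.mem_append] at hi ⊢
    tauto
  · simp only [List.mem_append] at hj ⊢
    tauto

open Classical in
/-- the sorting key of `w` -/
noncomputable def key (G : SimpleGraph V) (a b w : V) : Nat :=
  (if G.Adj a w then 2 else 0) + (if G.Adj b w then 1 else 0)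

theorem eval_lexs {Z : List Nat} (hZ : ∀ i ∈ Z, i + 1 < 7)
    (h : ∀ i ∈ Z, key G (f 0) (f 1) (f i) ≤ key G (f 0) (f 1) (f (i + 1))) :
    eval (asg G f) (lexs Z) = true := by
  unfold lexs
  rw [eval_all]
  intro i hi
  have h7 := hZ i hi
  have hk := h i hi
  simp only [eval_and, eval_or]
  rw [eval_ed_false G f 0 i (by omega) (by omega), eval_ed_true G f 0 (i + 1) (by omega) h7,
    eval_ed_false G f 1 i (by omega) (by omega), eval_ed_true G f 1 (i + 1) (by omega) h7]
  unfold key at hk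
  by_cases h1 : G.Adj (f 0) (f i) <;> by_cases h2 : G.Adj (f 0) (f (i + 1)) <;>
    by_cases h3 : G.Adj (f 1) (f i) <;> by_cases h4 : G.Adj (f 1) (f (i + 1)) <;>
    simp [h1, h2, h3, h4] at hk ⊢

/-- A labelling with sorted keys. -/
theorem exists_label [Finite V] (G : SimpleGraph V) (P Q : Set V) (p q : Nat)
    (hdisj : ∀ w, w ∈ P → w ∈ Q → False)
    (hp : P.ncard = p) (hq : Q.ncard = q) (hp0 : 0 < p) (h7 : p + q = 7) :
    ∃ f : Nat → V, Enum f (List.range' 0 p) P ∧ Enum f (List.range' p q) Q ∧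
      (∀ i ∈ List.range' 0 p ++ List.range' p q, ∀ j ∈ List.range' 0 p ++ List.range' p q,
        f i = f j → i = j) ∧
      (2 ≤ p → ∀ i, p ≤ i → i + 1 < 7 →
        key G (f 0) (f 1) (f i) ≤ key G (f 0) (f 1) (f (i + 1))) := by
  have eP : Fin p ≃ P := (Finite.equivFinOfCardEq (by rwa [Nat.card_coe_set_eq])).symm
  have eQ : Fin q ≃ Q := (Finite.equivFinOfCardEq (by rwa [Nat.card_coe_set_eq])).symm
  let r0 : V := (eP ⟨0, hp0⟩ : V)
  let r1 : V := if h : 1 < p then (eP ⟨1, h⟩ : V) else r0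
  let k : Fin q → Nat := fun i => key G r0 r1 (eQ i)
  let σ := Tuple.sort k
  have hmono : Monotone (k ∘ σ) := Tuple.monotone_sort k
  let f : Nat → V := fun i => if h : i < p then (eP ⟨i, h⟩ : V) else
    if h' : i - p < q then (eQ (σ ⟨i - p, h'⟩) : V) else r0
  have fP : ∀ i (h : i < p), f i = eP ⟨i, h⟩ := fun i h => by simp [f, h]
  have fQ : ∀ i, ¬ i < p → ∀ h' : i - p < q, f i = eQ (σ ⟨i - p, h'⟩) :=
    fun i h h' => by simp [f, h, h']
  refine ⟨f, ⟨?_, ?_⟩, ⟨?_, ?_⟩, ?_, ?_⟩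
  · intro i hi
    simp only [List.mem_range'_1] at hi
    rw [fP i (by omega)]
    exact ⟨by omega, Subtype.coe_prop _⟩
  · intro w hw
    refine ⟨(eP.symm ⟨w, hw⟩ : Fin p), ?_, ?_⟩
    · simp only [List.mem_range'_1]
      have := (eP.symm ⟨w, hw⟩).2
      omega
    · rw [fP _ (eP.symm ⟨w, hw⟩).2]
      simp
  · intro i hi
    simp only [List.mem_range'_1] at hi
    rw [fQ i (by omega) (by omega)]
    exact ⟨by omega, Subtype.coe_prop _⟩
  · intro w hw
    have hlt := (σ.symm (eQ.symm ⟨w, hw⟩)).2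
    refine ⟨p + (σ.symm (eQ.symm ⟨w, hw⟩) : Fin q), ?_, ?_⟩
    · simp only [List.mem_range'_1]
      omega
    · rw [fQ _ (by omega) (by omega)]
      simp
  · intro i hi j hj hij
    simp only [List.mem_append, List.mem_range'_1] at hi hj
    by_cases h1 : i < p <;> by_cases h2 : j < p
    · rw [fP i h1, fP j h2] at hij
      have := eP.injective (Subtype.ext hij)
      simpa using this
    · rw [fP i h1, fQ j h2 (by omega)] at hij
      exact (hdisj (f i) (by rw [fP i h1]; exact Subtype.coe_prop _)
        (by rw [fP i h1, hij]; exact Subtype.coe_prop _)).elim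
    · rw [fP j h2, fQ i h1 (by omega)] at hij
      exact (hdisj (f j) (by rw [fP j h2]; exact Subtype.coe_prop _)
        (by rw [fP j h2, ← hij]; exact Subtype.coe_prop _)).elim
    · rw [fQ i h1 (by omega), fQ j h2 (by omega)] at hij
      have := σ.injective (eQ.injective (Subtype.ext hij))
      simp only [Fin.mk.injEq] at this
      omega
  · intro h2 i hi hi'
    have e0 : f 0 = r0 := fP 0 hp0
    have e1 : f 1 = r1 := by
      rw [fP 1 (by omega)]
      have : 1 < p := by omega
      simp [r1, this]
    rw [e0, e1, fQ i (by omega) (by omega), fQ (i + 1) (by omega) (by omega)]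
    refine hmono (a := ⟨i - p, by omega⟩) (b := ⟨i + 1 - p, by omega⟩) ?_
    simp only [Fin.mk_le_mk]
    omega

theorem Cfg.false_of_le [Finite V] (H : Cfg G P Q) (h7 : P.ncard + Q.ncard = 7)
    (h0 : 0 < P.ncard) (h3 : P.ncard ≤ 3) : False := by
  obtain ⟨p, hp⟩ : ∃ p, P.ncard = p := ⟨_, rfl⟩
  obtain ⟨q, hq⟩ : ∃ q, Q.ncard = q := ⟨_, rfl⟩
  rw [hp, hq] at h7
  rw [hp] at h0 h3
  obtain ⟨f, hX, hY, hinj, hs⟩ := exists_label G P Q p q H.disj hp hq h0 h7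
  have ht := eval_total H hX hY hinj
  have hcases : p = 1 ∨ p = 2 ∨ p = 3 := by omega
  rcases hcases with rfl | rfl | rfl
  · obtain rfl : q = 6 := by omega
    have := refute_sound (asg G f) _ _ refute1
    exact absurd (this.symm.trans ht) (by decide)
  · obtain rfl : q = 5 := by omega
    have := refute_sound (asg G f) _ _ refute2
    have hl : eval (asg G f) (lexs [2,3,4,5]) = true := by
      apply eval_lexs
      · simp
      · intro i hi
        simp only [List.mem_cons, List.not_mem_nil, or_false] at hi
        exact hs (by omega) i (by omega) (by omega)
    have := this.symm.trans ((eval_and _ _ _).2 ⟨hl, ht⟩)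
    exact absurd this (by decide)
  · obtain rfl : q = 4 := by omega
    have := refute_sound (asg G f) _ _ refute3
    have hl : eval (asg G f) (lexs [3,4,5]) = true := by
      apply eval_lexs
      · simp
      · intro i hi
        simp only [List.mem_cons, List.not_mem_nil, or_false] at hi
        exact hs (by omega) i (by omega) (by omega)
    have := this.symm.trans ((eval_and _ _ _).2 ⟨hl, ht⟩)
    exact absurd this (by decide)

theorem Cfg.swap (H : Cfg G P Q) : Cfg G Q P where
  disj w h1 h2 := H.disj w h2 h1
  nfP := H.nfQ
  nfQ := H.nfP
  nd c hc d hd := by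
    obtain ⟨u, hu, h1, h2⟩ := H.nd d hd c hc
    exact ⟨u, hu.symm, h2, h1⟩
  crP := H.crQ
  crQ := H.crP

theorem Cfg.false [Finite V] (H : Cfg G P Q) (h7 : P.ncard + Q.ncard = 7)
    (hP : 0 < P.ncard) (hQ : 0 < Q.ncard) : False := by
  by_cases h : P.ncard ≤ 3
  · exact H.false_of_le h7 hP h
  · exact H.swap.false_of_le (by omega) hQ (by omega)

end graph
end Fm

section reduction
variable {V : Type*} {G : SimpleGraph V}

theorem no_pair (h : gammaT G = 3) (a b : V) : ∃ w, ¬ G.Adj w a ∧ ¬ G.Adj w b := by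
  by_contra hcon
  push Not at hcon
  have hT : IsTDS G {a, b} := by
    intro w
    by_cases hw : G.Adj w a
    · exact ⟨a, by simp, hw⟩
    · exact ⟨b, by simp, hcon w hw⟩
  have h1 : gammaT G ≤ ({a, b} : Set V).ncard := Nat.sInf_le ⟨_, hT, rfl⟩
  have h2 : ({a, b} : Set V).ncard ≤ 2 := by
    have h3 := Set.ncard_insert_le a ({b} : Set V)
    rw [Set.ncard_singleton] at h3
    exact h3
  omega

theorem exists_tds {n : ℕ} (h : gammaT G = n + 1) : ∃ S : Set V, IsTDS G S ∧ S.ncard = n + 1 := by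
  have hne : {n : ℕ | ∃ S : Set V, IsTDS G S ∧ S.ncard = n}.Nonempty := by
    rw [Set.nonempty_iff_ne_empty]
    intro he
    unfold gammaT at h
    rw [he, Nat.sInf_empty] at h
    omega
  have := Nat.sInf_mem hne
  unfold gammaT at h
  rw [h] at this
  exact this

/-- `u` is critical, spelled out. -/
def CritAt (G : SimpleGraph V) (u : V) : Prop :=
  ∃ a b, a ≠ u ∧ b ≠ u ∧ ¬ G.Adj u a ∧ ¬ G.Adj u b ∧ G.Adj a b ∧
    ∀ w, w ≠ u → G.Adj w a ∨ G.Adj w b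

theorem critAt (h : gammaT G = 3) (u : V) (hu : gammaT (delVert G u) = 2) : CritAt G u := by
  obtain ⟨S, hS, hc⟩ := exists_tds hu
  obtain ⟨⟨a, ha⟩, ⟨b, hb⟩, -, rfl⟩ := Set.ncard_eq_two.1 hc
  have hdom : ∀ w, w ≠ u → G.Adj w a ∨ G.Adj w b := by
    intro w hw
    obtain ⟨z, hz, hadj⟩ := hS ⟨w, hw⟩
    simp only [Set.mem_insert_iff, Set.mem_singleton_iff] at hz
    rcases hz with rfl | rfl
    · exact Or.inl hadj
    · exact Or.inr hadj
  obtain ⟨w, hwa, hwb⟩ := no_pair h a b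
  have hwu : w = u := by
    by_contra hne
    rcases hdom w hne with h' | h'
    · exact hwa h'
    · exact hwb h'
  subst hwu
  refine ⟨a, b, ha, hb, hwa, hwb, ?_, hdom⟩
  rcases hdom a ha with h' | h'
  · exact (G.loopless.irrefl a h').elim
  · exact h'

theorem leaf_unique {l s t : V} (hl : deg G l = 1) (hs : G.Adj l s) (ht : G.Adj l t) : t = s := by
  obtain ⟨z, hz⟩ := Set.ncard_eq_one.1 hl
  have h1 : s ∈ G.neighborSet l := hs
  have h2 : t ∈ G.neighborSet l := ht
  rw [hz] at h1 h2
  rw [Set.mem_singleton_iff] at h1 h2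
  rw [h1, h2]

theorem nbr_support (h : IsThreeGammaTCritical G) {l s u : V} (hl : deg G l = 1)
    (hs : G.Adj l s) (hu : G.Adj s u) (hul : u ≠ l) : ∃ m, G.Adj u m ∧ deg G m = 1 := by
  by_contra hcon
  obtain ⟨a, b, -, -, hua, hub, -, hdom⟩ := critAt h.1 u (h.2 u hcon)
  rcases hdom l hul.symm with h' | h'
  · rw [leaf_unique hl hs h'] at hua
    exact hua hu.symm
  · rw [leaf_unique hl hs h'] at hub
    exact hub hu.symm

theorem support_mem {S : Set V} (hS : IsTDS G S) {u m : V} (hu : G.Adj u m) (hm : deg G m = 1) :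
    u ∈ S := by
  obtain ⟨z, hz, hadj⟩ := hS m
  rw [leaf_unique hm hu.symm hadj] at hz
  exact hz

theorem critSide_of (hv : ∀ u, CritAt G u) {v x y : V}
    (hxy : G.Adj x y) (hall : ∀ w, w = v ∨ w = x ∨ w = y ∨ G.Adj v w)
    (hvy : ¬ G.Adj v y)
    (hdisj : ∀ w, G.Adj v w → G.Adj x w → G.Adj y w → False) :
    Fm.CritSide G {w | G.Adj v w ∧ G.Adj x w} {w | G.Adj v w ∧ G.Adj y w} := by
  rintro a ⟨hva, hxa⟩
  have hay : ¬ G.Adj y a := fun h => hdisj a hva hxa h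
  have main : ∀ c d, G.Adj v c → ¬ G.Adj a c → ¬ G.Adj a d → G.Adj c d →
      (∀ w, w ≠ a → G.Adj w c ∨ G.Adj w d) →
      (∃ c ∈ {w | G.Adj v w ∧ G.Adj y w}, ¬ G.Adj a c ∧
        ∀ a' ∈ {w | G.Adj v w ∧ G.Adj x w}, a' ≠ a → G.Adj a' c) ∨
      ∃ c ∈ {w | G.Adj v w ∧ G.Adj x w}, ∃ d ∈ {w | G.Adj v w ∧ G.Adj y w}, G.Adj c d ∧
        ¬ G.Adj a c ∧ ¬ G.Adj a d ∧
        ∀ u, (u ∈ {w | G.Adj v w ∧ G.Adj x w} ∨ u ∈ {w | G.Adj v w ∧ G.Adj y w}) → u ≠ a →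
          G.Adj u c ∨ G.Adj u d := by
    intro c d hvc hac had hcd hdom
    rcases hall d with rfl | rfl | rfl | hvd
    · exact (had hva.symm).elim
    · exact (had hxa.symm).elim
    · left
      refine ⟨c, ⟨hvc, hcd.symm⟩, hac, ?_⟩
      rintro a' ⟨hva', hxa'⟩ hne
      rcases hdom a' hne with h' | h'
      · exact h'
      · exact (hdisj a' hva' hxa' h'.symm).elim
    · right
      have hy : y ≠ a := by
        rintro rfl
        exact hvy hva
      have hx : x ≠ a := hxa.ne
      have hdc := hdisj c hvc
      have hdd := hdisj d hvd
      rcases hdom x hx with h1 | h1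
      · have h2 : G.Adj y d := (hdom y hy).resolve_left (hdc h1)
        exact ⟨c, ⟨hvc, h1⟩, d, ⟨hvd, h2⟩, hcd, hac, had, fun u _ hu => hdom u hu⟩
      · have h2 : G.Adj y c := (hdom y hy).resolve_right (hdd h1)
        exact ⟨d, ⟨hvd, h1⟩, c, ⟨hvc, h2⟩, hcd.symm, had, hac, fun u _ hu => (hdom u hu).symm⟩
  obtain ⟨c, d, -, -, hac, had, hcd, hdom⟩ := hv a
  rcases hdom v hva.ne with h' | h'
  · exact main c d h' hac had hcd hdom
  · exact main d c h' had hac hcd.symm (fun w hw => (hdom w hw).symm)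

theorem nonfull_of (hγ : gammaT G = 3) {v x y : V}
    (hxy : G.Adj x y) (hall : ∀ w, w = v ∨ w = x ∨ w = y ∨ G.Adj v w)
    (hcov : ∀ w, G.Adj v w → G.Adj x w ∨ G.Adj y w) :
    ∀ a ∈ {w | G.Adj v w ∧ G.Adj x w}, ∃ b ∈ {w | G.Adj v w ∧ G.Adj y w}, ¬ G.Adj a b := by
  rintro a ⟨hva, hxa⟩
  obtain ⟨w, hwx, hwa⟩ := no_pair hγ x a
  rcases hall w with rfl | rfl | rfl | hw
  · exact (hwa hva).elim
  · exact (hwa hxa).elim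
  · exact (hwx hxy.symm).elim
  · refine ⟨w, ⟨hw, ?_⟩, fun h => hwa h.symm⟩
    exact (hcov w hw).resolve_left fun h => hwx h.symm

end reduction

/-- Theorem 2.10: there is no 3-γₜ-critical graph of order `Δ(G) + 3` with `Δ(G) = 7`,
i.e. no 3-γₜ-critical graph on 10 vertices has maximum degree 7. -/
theorem no_critical_maxDeg_seven {V : Type*} [Fintype V] (G : SimpleGraph V)
    (hΔ : maxDeg G = 7) (horder : Fintype.card V = maxDeg G + 3) :
    ¬ IsThreeGammaTCritical G := by
  intro hcrit
  have hγ := hcrit.1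
  rw [hΔ] at horder
  have hle : ∀ u, deg G u ≤ 7 := by
    intro u
    rw [← hΔ]
    exact Finset.le_sup (f := fun v => deg G v) (Finset.mem_univ u)
  have hne : Nonempty V := Fintype.card_pos_iff.1 (by omega)
  obtain ⟨v, -, hv⟩ := Finset.exists_mem_eq_sup Finset.univ Finset.univ_nonempty
    (fun v => deg G v)
  have hv7 : (G.neighborSet v).ncard = 7 := by
    rw [← hΔ]
    exact hv.symm
  obtain ⟨T, hT, hT3⟩ := exists_tds hγ
  have hvns : ¬ ∃ u, G.Adj v u ∧ deg G u = 1 := by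
    rintro ⟨l, hvl, hl⟩
    have hsub : G.neighborSet v \ {l} ⊆ T := by
      rintro u ⟨hu, hul⟩
      obtain ⟨m, hm, hm1⟩ := nbr_support hcrit hl hvl.symm hu hul
      exact support_mem hT hm hm1
    have h1 := Set.ncard_le_ncard hsub (Set.toFinite T)
    have h2 := Set.ncard_sdiff_singleton_add_one (s := G.neighborSet v) hvl (Set.toFinite _)
    omega
  obtain ⟨x, y, hxv, hyv, hvx, hvy, hxy, hdom⟩ := critAt hγ v (hcrit.2 v hvns)
  have hcov : ∀ w, G.Adj v w → G.Adj x w ∨ G.Adj y w := fun w hw =>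
    (hdom w hw.ne').imp SimpleGraph.Adj.symm SimpleGraph.Adj.symm
  have hall : ∀ w, w = v ∨ w = x ∨ w = y ∨ G.Adj v w := by
    have h1 : (insert v (insert x (insert y (G.neighborSet v)))).ncard = 10 := by
      rw [Set.ncard_insert_of_notMem, Set.ncard_insert_of_notMem, Set.ncard_insert_of_notMem, hv7]
      · exact hvy
      · simp only [Set.mem_insert_iff, SimpleGraph.mem_neighborSet, not_or]
        exact ⟨hxy.ne, hvx⟩
      · simp only [Set.mem_insert_iff, SimpleGraph.mem_neighborSet, not_or]
        exact ⟨hxv.symm, hyv.symm, G.loopless.irrefl v⟩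
    have h2 : insert v (insert x (insert y (G.neighborSet v))) = Set.univ := by
      apply Set.eq_of_subset_of_ncard_le (Set.subset_univ _)
      rw [h1, Set.ncard_univ, Nat.card_eq_fintype_card, horder]
    intro w
    have : w ∈ insert v (insert x (insert y (G.neighborSet v))) := by
      rw [h2]
      trivial
    simpa using this
  -- no leaves adjacent to x or y
  have hnl : ∀ x y, G.Adj x y → (∀ w, G.Adj v w → G.Adj x w ∨ G.Adj y w) → ¬ G.Adj v x →
      deg G x ≠ 1 := by
    intro x y hxy hcov hvx hx
    have hsub : G.neighborSet v \ {y} ⊆ T := by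
      rintro u ⟨hu, huy⟩
      have hyu : G.Adj y u := by
        rcases hcov u hu with h' | h'
        · exact (huy (leaf_unique hx hxy h')).elim
        · exact h'
      have hux : u ≠ x := by
        rintro rfl
        exact hvx hu
      obtain ⟨m, hm, hm1⟩ := nbr_support hcrit hx hxy hyu hux
      exact support_mem hT hm hm1
    have h1 := Set.ncard_le_ncard hsub (Set.toFinite T)
    have h2 := Set.ncard_le_ncard_sdiff_add_ncard (G.neighborSet v) {y} (Set.toFinite _)
    rw [Set.ncard_singleton] at h2
    omega
  have hcov' : ∀ w, G.Adj v w → G.Adj y w ∨ G.Adj x w := fun w hw => (hcov w hw).symm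
  have hnoleaf : ∀ u, deg G u ≠ 1 := by
    intro u hu
    rcases hall u with rfl | rfl | rfl | h'
    · have : deg G u = 7 := hv7
      omega
    · exact hnl u y hxy hcov hvx hu
    · exact hnl u x hxy.symm hcov' hvy hu
    · exact hvns ⟨u, h', hu⟩
  have hC : ∀ u, CritAt G u := fun u =>
    critAt hγ u (hcrit.2 u fun ⟨m, _, hm⟩ => hnoleaf m hm)
  have hdisj : ∀ w, G.Adj v w → G.Adj x w → G.Adj y w → False := by
    intro w hvw hxw hyw
    obtain ⟨z, hzv, hzw⟩ := no_pair hγ v w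
    rcases hall z with rfl | rfl | rfl | h'
    · exact hzw hvw
    · exact hzw hxw
    · exact hzw hyw
    · exact hzv h'.symm
  have hall' : ∀ w, w = v ∨ w = y ∨ w = x ∨ G.Adj v w := fun w => by
    have := hall w
    tauto
  have hdisj' : ∀ w, G.Adj v w → G.Adj y w → G.Adj x w → False :=
    fun w h1 h2 h3 => hdisj w h1 h3 h2
  have H : Fm.Cfg G {w | G.Adj v w ∧ G.Adj x w} {w | G.Adj v w ∧ G.Adj y w} :=
    { disj := fun w h1 h2 => hdisj w h1.1 h1.2 h2.2
      nfP := nonfull_of hγ hxy hall hcov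
      nfQ := nonfull_of hγ hxy.symm hall' hcov'
      nd := by
        rintro c ⟨hvc, hxc⟩ d ⟨hvd, hyd⟩
        obtain ⟨w, hwc, hwd⟩ := no_pair hγ c d
        refine ⟨w, ?_, fun h => hwc h.symm, fun h => hwd h.symm⟩
        rcases hall w with rfl | rfl | rfl | h'
        · exact (hwc hvc).elim
        · exact (hwc hxc).elim
        · exact (hwd hyd).elim
        · exact (hcov w h').imp (fun h => ⟨h', h⟩) (fun h => ⟨h', h⟩)
      crP := critSide_of hC hxy hall hvy hdisj
      crQ := critSide_of hC hxy.symm hall' hvx hdisj' }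
  have hsum : {w | G.Adj v w ∧ G.Adj x w}.ncard + {w | G.Adj v w ∧ G.Adj y w}.ncard = 7 := by
    rw [← hv7, ← Set.ncard_union_eq _ (Set.toFinite _) (Set.toFinite _)]
    · congr 1
      ext w
      simp only [Set.mem_union, Set.mem_ofPred_eq, SimpleGraph.mem_neighborSet]
      have := hcov w
      tauto
    · rw [Set.disjoint_left]
      rintro w ⟨h1, h2⟩ ⟨-, h3⟩
      exact hdisj w h1 h2 h3
  have hsmall : ∀ x y, G.Adj x y → ¬ G.Adj v y →
      {w | G.Adj v w ∧ G.Adj x w}.ncard ≤ 6 := by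
    intro x y hxy hvy
    have hsub : insert y {w | G.Adj v w ∧ G.Adj x w} ⊆ G.neighborSet x := by
      intro w hw
      rcases hw with rfl | hw
      · exact hxy
      · exact hw.2
    have h1 := Set.ncard_le_ncard hsub (Set.toFinite _)
    rw [Set.ncard_insert_of_notMem (fun h => hvy h.1) (Set.toFinite _)] at h1
    have h2 : (G.neighborSet x).ncard ≤ 7 := hle x
    omega
  have hs1 := hsmall x y hxy hvy
  have hs2 := hsmall y x hxy.symm hvx
  exact H.false hsum (by omega) (by omega)
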